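/- arXiv:1110.6583 — 2 statements merged into one kernel-verified Lean document; each statement's English description precedes it below -/
import Mathlib

section
/- Let K = (K_1,…,K_M) be an interaction pattern on an n-partite finite-dimensional Hilbert space H, let D_K = { R_K(ρ) = (γ_{K_1}(ρ),…,γ_{K_M}(ρ)) : ρ a density matrix on H } and, for a subspace V, let F_V = { R_K(σ) : σ a density matrix with range(σ) ⊆ V }. If V is K-correlated, then F_V is a face of the convex set D_K: F_V is convex, and whenever a line segment contained in D_K meets F_V at a point that is not an endpoint of the segment, the entire segment lies in F_V. -/
open scoped BigOperators ComplexOrder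

namespace Paper

/-- The index set of the computational basis of an `n`-partite Hilbert space
`H = H_1 ⊗ ⋯ ⊗ H_n` with `dim H_i = d i`. -/
abbrev Idx {n : ℕ} (d : Fin n → ℕ) : Type := ∀ i : Fin n, Fin (d i)

/-- The index set for the subsystems in `K ⊆ {1,…,n}`. -/
abbrev SubIdx {n : ℕ} (d : Fin n → ℕ) (K : Finset (Fin n)) : Type :=
  ∀ i : {j : Fin n // j ∈ K}, Fin (d i.1)

/-- The index set for the subsystems outside `K`. -/
abbrev CoIdx {n : ℕ} (d : Fin n → ℕ) (K : Finset (Fin n)) : Type :=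
  ∀ i : {j : Fin n // j ∉ K}, Fin (d i.1)

/-- Glue an index on `K` and an index on the complement of `K` to a full index. -/
def merge {n : ℕ} {d : Fin n → ℕ} (K : Finset (Fin n)) (a : SubIdx d K) (c : CoIdx d K) :
    Idx d := fun i => if h : i ∈ K then a ⟨i, h⟩ else c ⟨i, h⟩

/-- A density matrix: positive semidefinite with trace one. -/
def IsDensityMatrix {m : Type*} [Fintype m] (ρ : Matrix m m ℂ) : Prop :=
  ρ.PosSemidef ∧ ρ.trace = 1

/-- The reduced density matrix `γ_K(ρ)`: the partial trace of `ρ` over all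
subsystems outside `K`. -/
noncomputable def rdm {n : ℕ} {d : Fin n → ℕ} (K : Finset (Fin n))
    (ρ : Matrix (Idx d) (Idx d) ℂ) : Matrix (SubIdx d K) (SubIdx d K) ℂ :=
  fun a b => ∑ c : CoIdx d K, ρ (merge K a c) (merge K b c)

/-- The von Neumann entropy `S(ρ) = -Tr(ρ log ρ)`, computed through the eigenvalues. -/
noncomputable def entropy {m : Type*} [Fintype m] [DecidableEq m] (ρ : Matrix m m ℂ) : ℝ :=
  if h : ρ.IsHermitian then ∑ i, Real.negMulLog (h.eigenvalues i) else 0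

/-- `P` is the orthogonal projection (w.r.t. the standard inner product) onto `V`. -/
def IsProjectionOnto {m : Type*} [Fintype m] [DecidableEq m] (P : Matrix m m ℂ)
    (V : Submodule ℂ (m → ℂ)) : Prop :=
  P.IsHermitian ∧ P * P = P ∧ LinearMap.range P.mulVecLin = V

/-- The maximally mixed state `ρ_V = P_V / dim V` on `V`, expressed through a
projection `P` onto `V`. -/
noncomputable def mmix {m : Type*} [Fintype m] [DecidableEq m] (V : Submodule ℂ (m → ℂ))
    (P : Matrix m m ℂ) : Matrix m m ℂ :=
  ((Module.finrank ℂ V : ℂ))⁻¹ • P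

/-- A subspace `V` is `𝒦`-correlated if the maximally mixed state `ρ_V` on `V` is the
unique state of maximal von Neumann entropy among all states having the same
reduced density matrices `γ_K`, `K ∈ 𝒦`, as `ρ_V`. -/
def KCorrelated {n : ℕ} {d : Fin n → ℕ} (𝒦 : Finset (Finset (Fin n)))
    (V : Submodule ℂ (Idx d → ℂ)) : Prop :=
  ∃ P : Matrix (Idx d) (Idx d) ℂ, IsProjectionOnto P V ∧
    IsDensityMatrix (mmix V P) ∧
    ∀ σ : Matrix (Idx d) (Idx d) ℂ, IsDensityMatrix σ →
      (∀ K ∈ 𝒦, rdm K σ = rdm K (mmix V P)) → σ ≠ mmix V P →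
      entropy σ < entropy (mmix V P)

/-- `V` is the eigenspace of `H` for the eigenvalue `E`, and `E` is minimal
(`H - E•1` is positive semidefinite); i.e. `V` is the ground-state space of `H`
with ground energy `E`. -/
def IsGroundStateSpace {m : Type*} [Fintype m] [DecidableEq m] (H : Matrix m m ℂ) (E : ℝ)
    (V : Submodule ℂ (m → ℂ)) : Prop :=
  (H - (E : ℂ) • 1).PosSemidef ∧ ∀ v : m → ℂ, v ∈ V ↔ H.mulVec v = (E : ℂ) • v

/-- Restriction of a full index to the subsystems in `K`. -/
def restrict {n : ℕ} {d : Fin n → ℕ} (K : Finset (Fin n)) (x : Idx d) : SubIdx d K :=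
  fun i => x i.1

/-- Restriction of a full index to the subsystems outside `K`. -/
def corestrict {n : ℕ} {d : Fin n → ℕ} (K : Finset (Fin n)) (x : Idx d) : CoIdx d K :=
  fun i => x i.1

/-- The operator `B ⊗ I`: an operator `B` on the subsystems in `K`, tensored with the
identity on all other subsystems. -/
noncomputable def embed {n : ℕ} {d : Fin n → ℕ} (K : Finset (Fin n))
    (B : Matrix (SubIdx d K) (SubIdx d K) ℂ) : Matrix (Idx d) (Idx d) ℂ :=
  fun x y => if corestrict K x = corestrict K y then B (restrict K x) (restrict K y) else 0

/-- `A` acts nontrivially only on the subsystems in `K`. -/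
def ActsOn {n : ℕ} {d : Fin n → ℕ} (K : Finset (Fin n)) (A : Matrix (Idx d) (Idx d) ℂ) :
    Prop := ∃ B, A = embed K B

/-- `H` is `𝒦`-local: a sum of Hermitian terms, each acting nontrivially only on the
subsystems in some `K ∈ 𝒦`. -/
def IsKLocal {n : ℕ} {d : Fin n → ℕ} (𝒦 : Finset (Finset (Fin n)))
    (H : Matrix (Idx d) (Idx d) ℂ) : Prop :=
  ∃ (M : ℕ) (T : Fin M → Matrix (Idx d) (Idx d) ℂ),
    H = ∑ j, T j ∧ ∀ j, (T j).IsHermitian ∧ ∃ K ∈ 𝒦, ActsOn K (T j)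

/-- The subspace `S ⊗ (full space of the complement of K)` of the full Hilbert space. -/
noncomputable def liftSpace {n : ℕ} {d : Fin n → ℕ} (K : Finset (Fin n))
    (S : Submodule ℂ (SubIdx d K → ℂ)) : Submodule ℂ (Idx d → ℂ) where
  carrier := {x | ∀ c : CoIdx d K, (fun a => x (merge K a c)) ∈ S}
  zero_mem' := fun _ => S.zero_mem
  add_mem' := fun hx hy c => S.add_mem (hx c) (hy c)
  smul_mem' := fun t _ hx c => S.smul_mem t (hx c)


/-- The basis state `|v⟩`. -/
def ket {m : Type*} [DecidableEq m] (v : m) : m → ℂ := fun x => if x = v then 1 else 0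

/-- The pure-state density matrix `|ψ⟩⟨ψ|`. -/
def pureDM {m : Type*} (ψ : m → ℂ) : Matrix m m ℂ := Matrix.vecMulVec ψ (star ψ)

/-- `𝒦`-correlatedness for an interaction pattern given as a tuple `(K_1, …, K_M)`. -/
def KCorrelatedT {n : ℕ} {d : Fin n → ℕ} {M : ℕ} (K : Fin M → Finset (Fin n))
    (V : Submodule ℂ (Idx d → ℂ)) : Prop :=
  ∃ P : Matrix (Idx d) (Idx d) ℂ, IsProjectionOnto P V ∧
    IsDensityMatrix (mmix V P) ∧
    ∀ σ : Matrix (Idx d) (Idx d) ℂ, IsDensityMatrix σ →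
      (∀ j : Fin M, rdm (K j) σ = rdm (K j) (mmix V P)) → σ ≠ mmix V P →
      entropy σ < entropy (mmix V P)


section Helpers

open Matrix Unitary

variable {m : Type*} [Fintype m] [DecidableEq m]

lemma trace_conjAut (u : unitary (Matrix m m ℂ)) (A : Matrix m m ℂ) :
    (conjStarAlgAut ℂ _ u A).trace = A.trace := by
  rw [conjStarAlgAut_apply, Matrix.trace_mul_comm, ← mul_assoc]
  simp

lemma trace_sq_eq {A : Matrix m m ℂ} (hA : A.IsHermitian) :
    (A * A).trace = ∑ i, ((hA.eigenvalues i : ℂ)) ^ 2 := by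
  rw [← trace_conjAut (star hA.eigenvectorUnitary), map_mul,
    hA.conjStarAlgAut_star_eigenvectorUnitary, Matrix.diagonal_mul_diagonal,
    Matrix.trace_diagonal]
  simp [sq]

lemma sum_eig_eq_one {A : Matrix m m ℂ} (hA : A.IsHermitian) (h : A.trace = 1) :
    ∑ i, hA.eigenvalues i = 1 := by
  have := hA.trace_eq_sum_eigenvalues
  rw [h] at this
  have h2 := congrArg Complex.re this
  simpa using h2.symm

lemma negMulLog_lower {x c : ℝ} (hx : 0 ≤ x) (hc : 0 < c) :
    x * (Real.log c + 1) - c * x ^ 2 ≤ Real.negMulLog x := by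
  rcases hx.eq_or_lt with rfl | hx
  · simp
  have h := Real.log_le_sub_one_of_pos (mul_pos hc hx)
  rw [Real.log_mul hc.ne' hx.ne'] at h
  unfold Real.negMulLog
  nlinarith

lemma entropy_lower {A : Matrix m m ℂ} (hA : IsDensityMatrix A) {c : ℝ} (hc : 0 < c) :
    Real.log c + 1 - c * (A * A).trace.re ≤ entropy A := by
  have hH := hA.1.isHermitian
  have h1 := sum_eig_eq_one hH hA.2
  have h2 : (A * A).trace.re = ∑ i, (hH.eigenvalues i) ^ 2 := by
    rw [trace_sq_eq hH]
    have : (∑ i, ((hH.eigenvalues i : ℂ)) ^ 2) = ((∑ i, (hH.eigenvalues i) ^ 2 : ℝ) : ℂ) := by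
      push_cast; rfl
    rw [this, Complex.ofReal_re]
  have h3 : Real.log c + 1 = ∑ i, hH.eigenvalues i * (Real.log c + 1) := by
    rw [← Finset.sum_mul, h1, one_mul]
  rw [h2, h3, entropy, dif_pos hH, Finset.mul_sum, ← Finset.sum_sub_distrib]
  exact Finset.sum_le_sum fun i _ => negMulLog_lower (hA.1.eigenvalues_nonneg i) hc

lemma entropy_flat {A : Matrix m m ℂ} (hA : IsDensityMatrix A) {c : ℝ} (hc : 0 < c)
    (h : c • (A * A) = A) : entropy A = Real.log c := by
  have hH := hA.1.isHermitian
  have h1 := sum_eig_eq_one hH hA.2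
  have key : ∀ i, c * (hH.eigenvalues i * hH.eigenvalues i) = hH.eigenvalues i := by
    intro i
    have h' : (c : ℂ) • (A * A) = A := by
      rw [← h]; simp [h]
    have := congrArg (conjStarAlgAut ℂ _ (star hH.eigenvectorUnitary)) h'
    rw [map_smul, map_mul, hH.conjStarAlgAut_star_eigenvectorUnitary,
      Matrix.diagonal_mul_diagonal] at this
    have := congrFun (congrFun this i) i
    simp at this
    exact_mod_cast this
  rw [entropy, dif_pos hH, ← one_mul (Real.log c), ← h1, Finset.sum_mul]
  refine Finset.sum_congr rfl fun i _ => ?_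
  have k := key i
  generalize hH.eigenvalues i = x at k
  by_cases hx : x = 0
  · simp [hx]
  have : x = c⁻¹ := by
    field_simp
    have : x * (c * x - 1) = 0 := by linarith
    rcases mul_eq_zero.1 this with h | h
    · exact absurd h hx
    · linarith
  rw [this, Real.negMulLog, Real.log_inv]; ring

lemma one_sub_posSemidef {A : Matrix m m ℂ} (hA : IsDensityMatrix A) :
    (1 - A).PosSemidef := by
  have hH := hA.1.isHermitian
  have h1 := sum_eig_eq_one hH hA.2
  have hd : (Matrix.diagonal (fun i => 1 - (hH.eigenvalues i : ℂ))).PosSemidef := by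
    apply Matrix.PosSemidef.diagonal
    intro i
    have : hH.eigenvalues i ≤ 1 := by
      rw [← h1]
      exact Finset.single_le_sum (f := hH.eigenvalues)
        (fun j _ => hA.1.eigenvalues_nonneg j) (Finset.mem_univ i)
    have h2 : (0 : ℝ) ≤ 1 - hH.eigenvalues i := by linarith
    have h3 : (0 : ℂ) ≤ ((1 - hH.eigenvalues i : ℝ) : ℂ) := by exact_mod_cast h2
    simpa using h3
  have : 1 - A = conjStarAlgAut ℂ _ hH.eigenvectorUnitary
      (Matrix.diagonal (fun i => 1 - (hH.eigenvalues i : ℂ))) := by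
    have e : (Matrix.diagonal (fun i => 1 - (hH.eigenvalues i : ℂ))) =
        1 - Matrix.diagonal (RCLike.ofReal ∘ hH.eigenvalues) := by
      rw [← Matrix.diagonal_one, Matrix.diagonal_sub]; rfl
    rw [e, map_sub, map_one, ← hH.spectral_theorem]
  rw [this, conjStarAlgAut_apply, Matrix.star_eq_conjTranspose]
  exact hd.mul_mul_conjTranspose_same _

lemma range_le_iff {P A : Matrix m m ℂ} {V : Submodule ℂ (m → ℂ)}
    (hP : IsProjectionOnto P V) : LinearMap.range A.mulVecLin ≤ V ↔ P * A = A := by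
  obtain ⟨-, hPP, rfl⟩ := hP
  constructor
  · intro h
    apply Matrix.mulVec_injective
    funext v
    obtain ⟨w, hw⟩ := h ⟨v, rfl⟩
    simp only [Matrix.mulVecLin_apply] at hw
    rw [← Matrix.mulVec_mulVec, ← hw, Matrix.mulVec_mulVec, hPP]
  · rintro h _ ⟨v, rfl⟩
    refine ⟨A.mulVec v, ?_⟩
    simp [Matrix.mulVec_mulVec, h]

lemma IsDensityMatrix.mix {A B : Matrix m m ℂ} (hA : IsDensityMatrix A)
    (hB : IsDensityMatrix B) {a b : ℝ} (ha : 0 ≤ a) (hb : 0 ≤ b) (hab : a + b = 1) :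
    IsDensityMatrix (a • A + b • B) := by
  refine ⟨(hA.1.smul ha).add (hB.1.smul hb), ?_⟩
  rw [Matrix.trace_add, Matrix.trace_smul, Matrix.trace_smul, hA.2, hB.2, ← add_smul, hab, one_smul]

lemma proj_posSemidef {P : Matrix m m ℂ} (h1 : P.IsHermitian) (h2 : P * P = P) :
    P.PosSemidef := by
  have := Matrix.posSemidef_conjTranspose_mul_self P
  rwa [h1.eq, h2] at this

lemma trace_proj {Q A : Matrix m m ℂ} (h2 : Q * Q = Q) :
    (Q * A * Q).trace = (Q * A).trace := by
  rw [Matrix.trace_mul_comm, ← mul_assoc, h2]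

lemma trace_compl_nonneg {P A : Matrix m m ℂ} (h1 : P.IsHermitian) (h2 : P * P = P)
    (hA : IsDensityMatrix A) : (P * A).trace.re ≤ 1 := by
  have hQ1 : (1 - P).IsHermitian := Matrix.isHermitian_one.sub h1
  have hQ2 : (1 - P) * (1 - P) = 1 - P := by simp [mul_sub, sub_mul, h2]
  have := (hA.1.mul_mul_conjTranspose_same (1 - P)).trace_nonneg
  rw [hQ1.eq, trace_proj hQ2, sub_mul, one_mul, Matrix.trace_sub, hA.2] at this
  have := (Complex.le_def.1 this).1
  simpa using this

lemma supp_of_trace {P A : Matrix m m ℂ} (h1 : P.IsHermitian) (h2 : P * P = P)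
    (hA : IsDensityMatrix A) (h : 1 ≤ (P * A).trace.re) : P * A = A := by
  have hQ1 : (1 - P).IsHermitian := Matrix.isHermitian_one.sub h1
  have hQ2 : (1 - P) * (1 - P) = 1 - P := by simp [mul_sub, sub_mul, h2]
  have hps := hA.1.mul_mul_conjTranspose_same (1 - P)
  have hn := hps.trace_nonneg
  have hz : ((1 - P) * A * (1 - P)ᴴ).trace = 0 := by
    obtain ⟨hr, hi⟩ := Complex.le_def.1 hn
    apply Complex.ext
    · refine le_antisymm ?_ hr
      rw [hQ1.eq, trace_proj hQ2, sub_mul, one_mul, Matrix.trace_sub, hA.2]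
      simp; linarith
    · exact hi.symm
  obtain ⟨B, hB⟩ : ∃ B : Matrix m m ℂ, A = Bᴴ * B := by
    open scoped MatrixOrder in
    obtain ⟨B, hB⟩ := CStarAlgebra.nonneg_iff_eq_star_mul_self.1 hA.1.nonneg
    exact ⟨B, hB⟩
  have e : (1 - P) * A * (1 - P)ᴴ = (B * (1 - P)ᴴ)ᴴ * (B * (1 - P)ᴴ) := by
    simp only [hB, Matrix.conjTranspose_mul, Matrix.conjTranspose_conjTranspose, mul_assoc]
  rw [e, Matrix.trace_conjTranspose_mul_self_eq_zero_iff] at hz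
  have hz' : (1 - P) * Bᴴ = 0 := by
    have := congrArg Matrix.conjTranspose hz
    simpa [Matrix.conjTranspose_mul] using this
  have : (1 - P) * A = 0 := by rw [hB, ← mul_assoc, hz', zero_mul]
  rw [sub_mul, one_mul, sub_eq_zero] at this
  exact this.symm

lemma lin_nonneg {a b r : ℝ} (hr : 0 < r)
    (h : ∀ t : ℝ, 0 < t → t ≤ r → 0 ≤ t * a + t ^ 2 * b) : 0 ≤ a := by
  by_contra! ha
  set t := min r (-a / (2 * (|b| + 1))) with ht
  have hb : 0 < 2 * (|b| + 1) := by positivity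
  have h0 : 0 < t := lt_min hr (div_pos (by linarith) hb)
  have h1 : t * (2 * (|b| + 1)) ≤ -a := by
    have : t ≤ -a / (2 * (|b| + 1)) := min_le_right _ _
    rwa [le_div_iff₀ hb] at this
  have h2 := h t h0 (min_le_left _ _)
  have h3 : 0 ≤ a + t * b := by
    by_contra! h4
    nlinarith
  have h5 : t * b ≤ t * |b| := by gcongr; exact le_abs_self b
  nlinarith

end Helpers

lemma rdm_add {n : ℕ} {d : Fin n → ℕ} (K : Finset (Fin n)) (A B : Matrix (Idx d) (Idx d) ℂ) :
    rdm K (A + B) = rdm K A + rdm K B := by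
  ext a b; simp [rdm, Finset.sum_add_distrib]

lemma rdm_smul {n : ℕ} {d : Fin n → ℕ} (K : Finset (Fin n)) (t : ℝ)
    (A : Matrix (Idx d) (Idx d) ℂ) : rdm K (t • A) = t • rdm K A := by
  ext a b; simp [rdm, Finset.mul_sum]

lemma rdm_sub {n : ℕ} {d : Fin n → ℕ} (K : Finset (Fin n)) (A B : Matrix (Idx d) (Idx d) ℂ) :
    rdm K (A - B) = rdm K A - rdm K B := by
  ext a b; simp [rdm, Finset.sum_sub_distrib]

lemma key {n : ℕ} {d : Fin n → ℕ} {M : ℕ} (K : Fin M → Finset (Fin n))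
    (V : Submodule ℂ (Idx d → ℂ)) (P : Matrix (Idx d) (Idx d) ℂ) (hP : IsProjectionOnto P V)
    (hm : IsDensityMatrix (mmix V P))
    (hmax : ∀ σ : Matrix (Idx d) (Idx d) ℂ, IsDensityMatrix σ →
      (∀ j : Fin M, rdm (K j) σ = rdm (K j) (mmix V P)) → σ ≠ mmix V P →
      entropy σ < entropy (mmix V P))
    (ω σ : Matrix (Idx d) (Idx d) ℂ) (hω : IsDensityMatrix ω) (hσ : IsDensityMatrix σ)
    (hPσ : P * σ = σ) (hR : ∀ j, rdm (K j) ω = rdm (K j) σ) : 1 ≤ (P * ω).trace.re := by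
  obtain ⟨h1, h2, -⟩ := hP
  have hσP : σ * P = σ := by
    have := congrArg Matrix.conjTranspose hPσ
    rwa [Matrix.conjTranspose_mul, h1.eq, hσ.1.isHermitian.eq] at this
  obtain ⟨c, hc0, hmm⟩ : ∃ c : ℝ, 0 ≤ c ∧ mmix V P = c⁻¹ • P := by
    refine ⟨(Module.finrank ℂ V : ℝ), by positivity, ?_⟩
    ext i j; simp [mmix]
  rw [hmm] at hm hmax
  have hc : 0 < c := by
    refine lt_of_le_of_ne hc0 ?_
    rintro rfl
    simpa using hm.2
  have hflat : entropy (c⁻¹ • P) = Real.log c := by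
    apply entropy_flat hm hc
    rw [smul_mul_smul_comm, h2, smul_smul]
    congr 1; field_simp
  have hPtr : c⁻¹ • P.trace = 1 := by rw [← Matrix.trace_smul]; exact hm.2
  have hPps := proj_posSemidef h1 h2
  have hPs : (P - σ).PosSemidef := by
    have := (one_sub_posSemidef hσ).mul_mul_conjTranspose_same P
    rwa [h1.eq, mul_sub, sub_mul, mul_one, h2, hPσ, hσP] at this
  have main : ∀ t : ℝ, 0 < t → t ≤ c⁻¹ →
      0 ≤ t * (2 * c⁻¹ * ((P * ω).trace.re - 1)) + t ^ 2 * ((ω - σ) * (ω - σ)).trace.re := by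
    intro t ht htc
    have hτ : IsDensityMatrix (c⁻¹ • P + t • (ω - σ)) := by
      constructor
      · have e : c⁻¹ • P + t • (ω - σ) = (c⁻¹ - t) • P + t • (P - σ) + t • ω := by
          module
        rw [e]
        exact ((hPps.smul (sub_nonneg.2 htc)).add (hPs.smul ht.le)).add (hω.1.smul ht.le)
      · rw [Matrix.trace_add, hm.2, Matrix.trace_smul, Matrix.trace_sub, hω.2, hσ.2]
        simp
    have hent : entropy (c⁻¹ • P + t • (ω - σ)) ≤ Real.log c := by
      rw [← hflat]
      by_cases he : c⁻¹ • P + t • (ω - σ) = c⁻¹ • P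
      · rw [he]
      · refine (hmax _ hτ (fun j => ?_) he).le
        rw [rdm_add, rdm_smul, rdm_smul, rdm_sub, hR j]
        simp
    have hlow := entropy_lower hτ hc
    have htr : ((c⁻¹ • P + t • (ω - σ)) * (c⁻¹ • P + t • (ω - σ))).trace.re =
        c⁻¹ + t * (2 * c⁻¹ * ((P * ω).trace.re - 1))
          + t ^ 2 * ((ω - σ) * (ω - σ)).trace.re := by
      have e : ((c⁻¹ • P + t • (ω - σ)) * (c⁻¹ • P + t • (ω - σ))).trace =
          c⁻¹ • (c⁻¹ • P.trace) + (t * c⁻¹) • (P * (ω - σ)).trace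
          + (t * c⁻¹) • ((ω - σ) * P).trace + (t ^ 2) • ((ω - σ) * (ω - σ)).trace := by
        rw [add_mul, mul_add, mul_add]
        simp only [smul_mul_smul_comm, h2, Matrix.trace_add, Matrix.trace_smul]
        module
      rw [e, hPtr, Matrix.trace_mul_comm (ω - σ) P, mul_sub P, hPσ, Matrix.trace_sub, hσ.2]
      simp only [Complex.add_re, Complex.smul_re, Complex.sub_re, Complex.one_re, smul_eq_mul]
      ring
    rw [htr] at hlow
    have h5 : 1 ≤ c * (c⁻¹ + t * (2 * c⁻¹ * ((P * ω).trace.re - 1))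
          + t ^ 2 * ((ω - σ) * (ω - σ)).trace.re) := by linarith
    have h6 : c * c⁻¹ = 1 := mul_inv_cancel₀ hc.ne'
    by_contra! h7
    have := mul_neg_of_pos_of_neg hc h7
    linarith
  have h8 := lin_nonneg (inv_pos.2 hc) main
  have h9 : 0 < 2 * c⁻¹ := by positivity
  have := nonneg_of_mul_nonneg_right h8 h9
  linarith

/-- If `V` is `K`-correlated then `F_V` is a face of the convex set
`D_K` of tuples of reduced density matrices. -/
theorem face_of_KCorrelated {n : ℕ} {d : Fin n → ℕ} {M : ℕ} (K : Fin M → Finset (Fin n))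
    (V : Submodule ℂ (Idx d → ℂ)) (hV : KCorrelatedT K V)
    (D F : Set (∀ j : Fin M, Matrix (SubIdx d (K j)) (SubIdx d (K j)) ℂ))
    (hD : D = {x | ∃ ρ : Matrix (Idx d) (Idx d) ℂ,
      IsDensityMatrix ρ ∧ (fun j => rdm (K j) ρ) = x})
    (hF : F = {x | ∃ σ : Matrix (Idx d) (Idx d) ℂ, IsDensityMatrix σ ∧
      LinearMap.range σ.mulVecLin ≤ V ∧ (fun j => rdm (K j) σ) = x}) :
    Convex ℝ F ∧
    ∀ x ∈ D, ∀ y ∈ D, ∀ p : ℝ, p ∈ Set.Ioo (0 : ℝ) 1 →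
      (1 - p) • x + p • y ∈ F → x ∈ F ∧ y ∈ F := by
  subst hD hF
  obtain ⟨P, hP, hm, hmax⟩ := hV
  have hP' := hP
  obtain ⟨h1, h2, -⟩ := hP'
  constructor
  · rintro _ ⟨σ, hσ, hσV, rfl⟩ _ ⟨τ, hτ, hτV, rfl⟩ a b ha hb hab
    refine ⟨a • σ + b • τ, hσ.mix hτ ha hb hab, ?_, ?_⟩
    · rw [range_le_iff hP] at *
      rw [mul_add, mul_smul_comm, mul_smul_comm, hσV, hτV]
    · funext j
      simp [rdm_add, rdm_smul]
  · rintro _ ⟨ρ, hρ, rfl⟩ _ ⟨τ, hτ, rfl⟩ p ⟨hp0, hp1⟩ ⟨σ, hσ, hσV, hR⟩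
    rw [range_le_iff hP] at hσV
    have hω := hρ.mix hτ (sub_nonneg.2 hp1.le) hp0.le (sub_add_cancel 1 p)
    have hk := key K V P hP hm hmax _ σ hω hσ hσV (fun j => by
      have := congrFun hR j
      simp only [Pi.add_apply, Pi.smul_apply] at this
      rw [this, rdm_add, rdm_smul, rdm_smul])
    rw [mul_add, mul_smul_comm, mul_smul_comm, Matrix.trace_add, Matrix.trace_smul,
      Matrix.trace_smul, Complex.add_re, Complex.smul_re, Complex.smul_re, smul_eq_mul,
      smul_eq_mul] at hk
    have ha := trace_compl_nonneg h1 h2 hρ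
    have hb := trace_compl_nonneg h1 h2 hτ
    refine ⟨⟨ρ, hρ, (range_le_iff hP).2 (supp_of_trace h1 h2 hρ ?_), rfl⟩,
      ⟨τ, hτ, (range_le_iff hP).2 (supp_of_trace h1 h2 hτ ?_), rfl⟩⟩
    · by_contra! h
      nlinarith
    · by_contra! h
      nlinarith

end Paper
end

section
/- Let V be the ground-state space, with ground energy E_0, of a K-local Hamiltonian H = Σ_{j=1}^M H_j on an n-partite finite-dimensional Hilbert space, where H_j acts nontrivially only on the subsystems in K_j ∈ K. Then F_V = { R_K(σ) : range(σ) ⊆ V } is an exposed face of the convex set D_K = { R_K(ρ) : ρ a density matrix }: the affine functional f(γ_1,…,γ_M) = Σ_j Tr(H_j γ_j) − E_0 satisfies f ≥ 0 on D_K and F_V = { x ∈ D_K : f(x) = 0 }. -/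
open scoped BigOperators ComplexOrder

namespace Paper

/-- Splitting a full index into its restrictions to `K` and to the complement of `K`. -/
def splitEquiv {n : ℕ} {d : Fin n → ℕ} (K : Finset (Fin n)) :
    SubIdx d K × CoIdx d K ≃ Idx d where
  toFun p := merge K p.1 p.2
  invFun x := (restrict K x, corestrict K x)
  left_inv := by
    rintro ⟨a, c⟩
    ext i
    · simp [merge, restrict, i.2]
    · simp [merge, corestrict, i.2]
  right_inv := by
    intro x
    funext i
    by_cases h : i ∈ K <;> simp [merge, restrict, corestrict, h]

theorem restrict_merge {n : ℕ} {d : Fin n → ℕ} (K : Finset (Fin n)) (a : SubIdx d K)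
    (c : CoIdx d K) : restrict K (merge K a c) = a :=
  congrArg Prod.fst ((splitEquiv K).left_inv (a, c))

theorem corestrict_merge {n : ℕ} {d : Fin n → ℕ} (K : Finset (Fin n)) (a : SubIdx d K)
    (c : CoIdx d K) : corestrict K (merge K a c) = c :=
  congrArg Prod.snd ((splitEquiv K).left_inv (a, c))

theorem trace_embed_mul {n : ℕ} {d : Fin n → ℕ} (K : Finset (Fin n))
    (B : Matrix (SubIdx d K) (SubIdx d K) ℂ) (ρ : Matrix (Idx d) (Idx d) ℂ) :
    (embed K B * ρ).trace = (B * rdm K ρ).trace := by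
  have key : ∀ g : Idx d → ℂ, ∑ x, g x = ∑ a, ∑ c, g (merge K a c) := by
    intro g
    rw [← (splitEquiv K).sum_comp, Fintype.sum_prod_type]
    rfl
  simp only [Matrix.trace, Matrix.diag, Matrix.mul_apply, rdm, embed]
  rw [key]
  refine Finset.sum_congr rfl fun a _ => ?_
  simp only [key, restrict_merge, corestrict_merge, Finset.mul_sum]
  rw [Finset.sum_comm]
  refine Finset.sum_congr rfl fun b _ => ?_
  refine Finset.sum_congr rfl fun c _ => ?_
  simp [ite_mul]

open scoped MatrixOrder in
theorem psd_trace {m : Type*} [Fintype m] [DecidableEq m] {A ρ : Matrix m m ℂ}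
    (hA : A.PosSemidef) (hρ : ρ.PosSemidef) :
    0 ≤ (A * ρ).trace ∧ ((A * ρ).trace = 0 → A * ρ = 0) := by
  obtain ⟨B, rfl⟩ := (CStarAlgebra.nonneg_iff_eq_star_mul_self).mp hA.nonneg
  obtain ⟨C, rfl⟩ := (CStarAlgebra.nonneg_iff_eq_star_mul_self).mp hρ.nonneg
  have h : (B.conjTranspose * B * (C.conjTranspose * C)).trace
      = ((B * C.conjTranspose).conjTranspose * (B * C.conjTranspose)).trace := by
    rw [← Matrix.mul_assoc, Matrix.trace_mul_comm]
    simp [Matrix.mul_assoc]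
  simp only [Matrix.star_eq_conjTranspose]
  rw [h]
  refine ⟨(Matrix.posSemidef_conjTranspose_mul_self _).trace_nonneg, fun h0 => ?_⟩
  have h1 := Matrix.trace_conjTranspose_mul_self_eq_zero_iff.mp h0
  calc B.conjTranspose * B * (C.conjTranspose * C)
      = B.conjTranspose * (B * C.conjTranspose) * C := by simp only [Matrix.mul_assoc]
    _ = 0 := by rw [h1]; simp

/-- The ground-state space `V` of a `K`-local Hamiltonian
`H = ∑ⱼ Hⱼ` (with `Hⱼ` supported on `K j`) gives an exposed face `F_V` of `D_K`:
the affine functional `f(γ₁,…,γ_M) = ∑ⱼ Tr(Hⱼ γⱼ) − E₀` is nonnegative on `D_K`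
and vanishes exactly on `F_V`. -/
theorem exposed_face_of_groundStateSpace {n : ℕ} {d : Fin n → ℕ} {M : ℕ}
    (K : Fin M → Finset (Fin n))
    (Hj : ∀ j : Fin M, Matrix (SubIdx d (K j)) (SubIdx d (K j)) ℂ)
    (hherm : ∀ j, (Hj j).IsHermitian)
    (E0 : ℝ) (V : Submodule ℂ (Idx d → ℂ))
    (hgs : IsGroundStateSpace (∑ j, embed (K j) (Hj j)) E0 V)
    (D F : Set (∀ j : Fin M, Matrix (SubIdx d (K j)) (SubIdx d (K j)) ℂ))
    (hD : D = {x | ∃ ρ : Matrix (Idx d) (Idx d) ℂ,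
      IsDensityMatrix ρ ∧ (fun j => rdm (K j) ρ) = x})
    (hF : F = {x | ∃ σ : Matrix (Idx d) (Idx d) ℂ, IsDensityMatrix σ ∧
      LinearMap.range σ.mulVecLin ≤ V ∧ (fun j => rdm (K j) σ) = x})
    (f : (∀ j : Fin M, Matrix (SubIdx d (K j)) (SubIdx d (K j)) ℂ) → ℝ)
    (hf : f = fun x => (∑ j, (Hj j * x j).trace).re - E0) :
    (∀ x ∈ D, 0 ≤ f x) ∧ F = {x | x ∈ D ∧ f x = 0} := by
  obtain ⟨hpsd, hV⟩ := hgs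
  set H := ∑ j, embed (K j) (Hj j) with hH
  have hfr : ∀ ρ : Matrix (Idx d) (Idx d) ℂ, IsDensityMatrix ρ →
      f (fun j => rdm (K j) ρ) = ((H - (E0 : ℂ) • 1) * ρ).trace.re := by
    intro ρ hρ
    simp only [hf, ← trace_embed_mul]
    rw [Matrix.sub_mul, Matrix.trace_sub, hH, Matrix.sum_mul, Matrix.trace_sum]
    simp [hρ.2]
  have hAr : ∀ σ : Matrix (Idx d) (Idx d) ℂ,
      LinearMap.range σ.mulVecLin ≤ V ↔ (H - (E0 : ℂ) • 1) * σ = 0 := by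
    intro σ
    have h1 : ∀ v, σ.mulVec v ∈ V ↔ ((H - (E0 : ℂ) • 1) * σ).mulVec v = 0 := by
      intro v
      rw [hV, ← Matrix.mulVec_mulVec, Matrix.sub_mulVec, Matrix.smul_mulVec, Matrix.one_mulVec,
        sub_eq_zero]
    constructor
    · intro h
      apply Matrix.mulVec_injective
      funext v
      rw [(h1 v).mp (h ⟨v, rfl⟩), Matrix.zero_mulVec]
    · rintro h _ ⟨v, rfl⟩
      exact (h1 v).mpr (by rw [h, Matrix.zero_mulVec])
  subst hD hF
  refine ⟨?_, ?_⟩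
  · rintro _ ⟨ρ, hρ, rfl⟩
    rw [hfr ρ hρ]
    exact (Complex.le_def.mp (psd_trace hpsd hρ.1).1).1
  · ext x
    constructor
    · rintro ⟨σ, hσ, hr, rfl⟩
      refine ⟨⟨σ, hσ, rfl⟩, ?_⟩
      rw [hfr σ hσ, (hAr σ).mp hr]
      simp
    · rintro ⟨⟨ρ, hρ, rfl⟩, h0⟩
      refine ⟨ρ, hρ, (hAr ρ).mpr ?_, rfl⟩
      rw [hfr ρ hρ] at h0
      have h := psd_trace hpsd hρ.1
      exact h.2 (Complex.ext h0 (Complex.le_def.mp h.1).2.symm)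

end Paper
end
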